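/- arXiv:2504.09126 — 2 statements merged into one kernel-verified Lean document; each statement's English description precedes it below -/
import Mathlib

section
/- Assume that g and l are both self-reciprocal. If gcd(r22(x), g11(x)·ḡ12(x) − g12(x)·ḡ11(x)) ≠ 1, then the code C is not symplectic LCD. -/
open Polynomial

noncomputable section

/-- The coefficient vector (of length `m`) of the canonical representative of an
element of `R = F[x]/(x^m - 1)`.  Under the identification of `R²` with `F^{2m}` a pair
`(a(x), b(x))` corresponds to the concatenation of the two coefficient vectors. -/
def qcToVec {F : Type} [Field F] {m : ℕ} (hm : 0 < m)
    (a : AdjoinRoot (X ^ m - 1 : F[X])) : Fin m → F := fun i =>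
  (AdjoinRoot.modByMonicHom
    (show (X ^ m - 1 : F[X]).Monic by
      simpa using monic_X_pow_sub_C (1 : F) hm.ne') a).coeff i

/-- The symplectic inner product on `R × R`: writing vectors of `F^{2m}` as `(x1 | x2)`,
`⟨(x1|x2),(y1|y2)⟩_s = ⟨x1,y2⟩_e - ⟨x2,y1⟩_e`. -/
def qcSympInner {F : Type} [Field F] {m : ℕ} (hm : 0 < m)
    (u v : AdjoinRoot (X ^ m - 1 : F[X]) × AdjoinRoot (X ^ m - 1 : F[X])) : F :=
  (∑ i, qcToVec hm u.1 i * qcToVec hm v.2 i) -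
    ∑ i, qcToVec hm u.2 i * qcToVec hm v.1 i

/-- A code `C ⊆ R²` is LCD with respect to a pairing `inner` if it meets its dual
trivially, i.e. `C ∩ C^⊥ = {0}` where `C^⊥ = {v : ∀ c ∈ C, inner c v = 0}`. -/
def IsLCDWith {F : Type} [Field F] {m : ℕ}
    (Cd : Submodule (AdjoinRoot (X ^ m - 1 : F[X]))
      (AdjoinRoot (X ^ m - 1 : F[X]) × AdjoinRoot (X ^ m - 1 : F[X])))
    (inner : (AdjoinRoot (X ^ m - 1 : F[X]) × AdjoinRoot (X ^ m - 1 : F[X])) →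
      (AdjoinRoot (X ^ m - 1 : F[X]) × AdjoinRoot (X ^ m - 1 : F[X])) → F) : Prop :=
  ∀ v ∈ Cd, (∀ c ∈ Cd, inner c v = 0) → v = 0

/-- `f` is self-reciprocal: the reciprocal polynomial `f*(x) = x^(deg f)·f(1/x)` is a
nonzero scalar multiple of `f`. -/
def IsSelfReciprocal {F : Type} [Field F] (f : F[X]) : Prop :=
  ∃ α : F, α ≠ 0 ∧ f.reverse = Polynomial.C α * f

section

variable {F : Type} [Field F] {m : ℕ}

lemma root_pow_eq_one : AdjoinRoot.root (X ^ m - 1 : F[X]) ^ m = 1 := by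
  have h := AdjoinRoot.mk_self (f := (X ^ m - 1 : F[X]))
  rwa [map_sub, map_pow, AdjoinRoot.mk_X, map_one, sub_eq_zero] at h

/-- The conjugation `x ↦ x⁻¹` of `F[x]/(x^m - 1)`. -/
def qcConj : AdjoinRoot (X ^ m - 1 : F[X]) →ₐ[F] AdjoinRoot (X ^ m - 1 : F[X]) :=
  AdjoinRoot.liftAlgHom _ (Algebra.ofId F _) (AdjoinRoot.root (X ^ m - 1 : F[X]) ^ (m - 1)) (by
    have h : (AdjoinRoot.root (X ^ m - 1 : F[X]) ^ (m - 1)) ^ m = 1 := by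
      rw [← pow_mul, mul_comm, pow_mul, root_pow_eq_one, one_pow]
    simp [h])

lemma qcConj_root :
    qcConj (AdjoinRoot.root (X ^ m - 1 : F[X])) = AdjoinRoot.root (X ^ m - 1 : F[X]) ^ (m - 1) := by
  simp [qcConj]

lemma root_mul_qcConj_root (hm : 0 < m) :
    AdjoinRoot.root (X ^ m - 1 : F[X]) * qcConj (AdjoinRoot.root (X ^ m - 1 : F[X])) = 1 := by
  rw [qcConj_root, ← pow_succ', Nat.sub_add_cancel hm, root_pow_eq_one]

lemma qcConj_qcConj (hm : 0 < m) (a : AdjoinRoot (X ^ m - 1 : F[X])) :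
    qcConj (qcConj a) = a := by
  suffices h : (qcConj.comp qcConj : AdjoinRoot (X ^ m - 1 : F[X]) →ₐ[F] _) = AlgHom.id F _ from
    DFunLike.congr_fun h a
  apply AdjoinRoot.algHom_ext
  have h := root_mul_qcConj_root (F := F) hm
  have h' := congrArg qcConj h
  rw [map_mul, map_one] at h'
  simp only [AlgHom.comp_apply, AlgHom.id_apply]
  calc _ = (AdjoinRoot.root (X ^ m - 1 : F[X]) * qcConj (AdjoinRoot.root (X ^ m - 1 : F[X]))) *
        qcConj (qcConj (AdjoinRoot.root (X ^ m - 1 : F[X]))) := by rw [h, one_mul]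
    _ = _ := by rw [mul_assoc, h', mul_one]

lemma mk_reflect (hm : 0 < m) (f : F[X]) (hf : f.natDegree ≤ m) :
    AdjoinRoot.mk (X ^ m - 1 : F[X]) (reflect m f) = qcConj (AdjoinRoot.mk _ f) := by
  refine Polynomial.induction_with_natDegree_le
    (fun f => AdjoinRoot.mk (X ^ m - 1 : F[X]) (reflect m f) = qcConj (AdjoinRoot.mk _ f))
    m ?_ ?_ ?_ f hf
  · simp
  · intro n a _ hn
    have h : AdjoinRoot.root (X ^ m - 1 : F[X]) ^ (m - n) =
        qcConj (AdjoinRoot.root (X ^ m - 1 : F[X])) ^ n := by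
      have h1 : AdjoinRoot.root (X ^ m - 1 : F[X]) ^ n *
          qcConj (AdjoinRoot.root (X ^ m - 1 : F[X])) ^ n = 1 := by
        rw [← mul_pow, root_mul_qcConj_root hm, one_pow]
      calc _ = AdjoinRoot.root (X ^ m - 1 : F[X]) ^ (m - n) *
            (AdjoinRoot.root (X ^ m - 1 : F[X]) ^ n *
              qcConj (AdjoinRoot.root (X ^ m - 1 : F[X])) ^ n) := by rw [h1, mul_one]
        _ = _ := by rw [← mul_assoc, ← pow_add, Nat.sub_add_cancel hn, root_pow_eq_one, one_mul]
    have h2 : qcConj (AdjoinRoot.of (X ^ m - 1 : F[X]) a) = AdjoinRoot.of _ a :=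
      (qcConj (F := F) (m := m)).commutes a
    rw [reflect_C_mul_X_pow, revAt_le hn]
    simp [h, h2]
  · intro f g _ _ h1 h2
    simp [reflect_add, h1, h2]

/-- The constant coefficient of the canonical representative. -/
def qcConstCoeff (hm : 0 < m) : AdjoinRoot (X ^ m - 1 : F[X]) →ₗ[F] F :=
  (lcoeff F 0).comp (AdjoinRoot.modByMonicHom
    (show (X ^ m - 1 : F[X]).Monic by
      simpa using monic_X_pow_sub_C (1 : F) hm.ne'))

lemma qcConstCoeff_root_pow (hm : 0 < m) {k : ℕ} (hk : k < m) :
    qcConstCoeff hm (AdjoinRoot.root (X ^ m - 1 : F[X]) ^ k) = if k = 0 then 1 else 0 := by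
  have hd : (X ^ k : F[X]).degree < (X ^ m - 1 : F[X]).degree := by
    rw [← C_1, degree_X_pow_sub_C hm, degree_X_pow]
    exact_mod_cast hk
  have hmon : (X ^ m - 1 : F[X]).Monic := by
    simpa using monic_X_pow_sub_C (1 : F) hm.ne'
  rw [← AdjoinRoot.mk_X, ← map_pow]
  simp only [qcConstCoeff, LinearMap.comp_apply, AdjoinRoot.modByMonicHom_mk,
    (modByMonic_eq_self_iff hmon).2 hd, lcoeff_apply, coeff_X_pow, eq_comm]

lemma qcConstCoeff_root_pow_mul_qcConj (hm : 0 < m) (i j : Fin m) :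
    qcConstCoeff hm (AdjoinRoot.root (X ^ m - 1 : F[X]) ^ (i : ℕ) *
      qcConj (AdjoinRoot.root (X ^ m - 1 : F[X]) ^ (j : ℕ))) = if i = j then 1 else 0 := by
  have hx := root_mul_qcConj_root (F := F) hm
  have hp := root_pow_eq_one (F := F) (m := m)
  set x := AdjoinRoot.root (X ^ m - 1 : F[X])
  have hj : x ^ (j : ℕ) * qcConj x ^ (j : ℕ) = 1 := by rw [← mul_pow, hx, one_pow]
  rw [map_pow]
  rcases le_or_gt j i with h | h
  · have h' : (j : ℕ) ≤ i := h
    have e : x ^ (i : ℕ) * qcConj x ^ (j : ℕ) = x ^ ((i : ℕ) - j) := by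
      rw [← Nat.sub_add_cancel h', pow_add, mul_assoc, hj, mul_one, Nat.add_sub_cancel]
    rw [e, qcConstCoeff_root_pow hm (by omega)]
    congr 1
    simp only [Fin.ext_iff, eq_iff_iff]
    omega
  · have h' : (i : ℕ) < j := h
    have e : x ^ (i : ℕ) * qcConj x ^ (j : ℕ) = x ^ (m - ((j : ℕ) - i)) := by
      calc _ = x ^ m * (x ^ (i : ℕ) * qcConj x ^ (j : ℕ)) := by rw [hp, one_mul]
        _ = x ^ (m - ((j : ℕ) - i)) * (x ^ (j : ℕ) * qcConj x ^ (j : ℕ)) := by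
          rw [← mul_assoc, ← mul_assoc, ← pow_add, ← pow_add]
          congr 2
          omega
        _ = _ := by rw [hj, mul_one]
    rw [e, qcConstCoeff_root_pow hm (by omega), if_neg (by omega), if_neg h.ne]

lemma sum_qcToVec (hm : 0 < m) (a : AdjoinRoot (X ^ m - 1 : F[X])) :
    ∑ i, qcToVec hm a i • AdjoinRoot.root (X ^ m - 1 : F[X]) ^ (i : ℕ) = a := by
  have hmon : (X ^ m - 1 : F[X]).Monic := by
    simpa using monic_X_pow_sub_C (1 : F) hm.ne'
  have hd : (AdjoinRoot.modByMonicHom hmon a).degree < m := by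
    obtain ⟨f, rfl⟩ := AdjoinRoot.mk_surjective a
    rw [AdjoinRoot.modByMonicHom_mk]
    refine (degree_modByMonic_lt f hmon).trans_eq ?_
    rw [← C_1, degree_X_pow_sub_C hm]
  have hn : (AdjoinRoot.modByMonicHom hmon a).natDegree < m := by
    by_cases h0 : AdjoinRoot.modByMonicHom hmon a = 0
    · rwa [h0, natDegree_zero]
    · exact (natDegree_lt_iff_degree_lt h0).2 hd
  conv_rhs => rw [← AdjoinRoot.mk_leftInverse hmon a]
  rw [(AdjoinRoot.modByMonicHom hmon a).as_sum_range' m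
    hn, map_sum, ← Fin.sum_univ_eq_sum_range
    (fun i => AdjoinRoot.mk (X ^ m - 1 : F[X])
      (monomial i ((AdjoinRoot.modByMonicHom hmon a).coeff i)))]
  refine Finset.sum_congr rfl fun i _ => ?_
  rw [← C_mul_X_pow_eq_monomial, map_mul, map_pow, AdjoinRoot.mk_X, AdjoinRoot.mk_C,
    Algebra.smul_def]
  rfl

lemma sum_qcToVec_mul (hm : 0 < m) (a b : AdjoinRoot (X ^ m - 1 : F[X])) :
    ∑ i, qcToVec hm a i * qcToVec hm b i = qcConstCoeff hm (a * qcConj b) := by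
  conv_rhs => rw [← sum_qcToVec hm a, ← sum_qcToVec hm b]
  simp only [map_sum, map_smul, Finset.sum_mul_sum, smul_mul_smul_comm,
    qcConstCoeff_root_pow_mul_qcConj, smul_eq_mul, mul_ite, mul_one, mul_zero,
    Finset.sum_ite_eq, Finset.mem_univ, if_true]

lemma qcSympInner_eq (hm : 0 < m)
    (u v : AdjoinRoot (X ^ m - 1 : F[X]) × AdjoinRoot (X ^ m - 1 : F[X])) :
    qcSympInner hm u v = qcConstCoeff hm (u.1 * qcConj v.2 - u.2 * qcConj v.1) := by
  rw [qcSympInner, sum_qcToVec_mul, sum_qcToVec_mul, map_sub]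

lemma separable_X_pow_sub_one_of_coprime_card [Fintype F]
    (hqm : Nat.Coprime (Fintype.card F) m) : (X ^ m - 1 : F[X]).Separable := by
  rw [X_pow_sub_one_separable_iff]
  intro h
  have hp := CharP.char_is_prime F (ringChar F)
  have h1 : ringChar F ∣ m := (ringChar.spec F m).1 h
  have h2 : ringChar F ∣ Fintype.card F := (ringChar.spec F _).1 (Nat.cast_card_eq_zero F)
  exact hp.one_lt.ne' (Nat.dvd_one.1 (hqm ▸ Nat.dvd_gcd h2 h1))

lemma reflect_eq_reverse_mul (f : F[X]) (hf : f.natDegree ≤ m) :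
    reflect m f = f.reverse * X ^ (m - f.natDegree) := by
  have h := reflect_mul f 1 le_rfl (show (1 : F[X]).natDegree ≤ m - f.natDegree by simp)
  rw [Nat.add_sub_cancel' hf, mul_one, reflect_one] at h
  exact h

end

/-- Assume `g` and `l` are self-reciprocal.  If
`gcd(r22, g11·ḡ12 - g12·ḡ11) ≠ 1` then the quasi-cyclic code
`C = ⟨(g11, g12), (0, g22)⟩` is not symplectic LCD. -/
theorem stmt13 (F : Type) [Field F] [Fintype F] [DecidableEq F] (m : ℕ) (hm : 0 < m)
    (hqm : Nat.Coprime (Fintype.card F) m)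
    (g11 g12 g22 : F[X])
    (h1 : g11 ∣ X ^ m - 1) (h2 : g22 ∣ X ^ m - 1)
    (h3 : g12.degree < g22.degree) (h4 : g11 * g22 ∣ (X ^ m - 1) * g12)
    (g l g11' g22' r11 t11 r22 t22 : F[X])
    (hg : g = gcd g11 g22) (hl : l = (X ^ m - 1) / lcm g11 g22)
    (h11' : g11' = g11 / g) (h22' : g22' = g22 / g)
    (hr11 : r11 = gcd g11' g11'.reverse) (ht11 : t11 = g11' / r11)
    (hr22 : r22 = gcd g22' g22'.reverse) (ht22 : t22 = g22' / r22)
    (hsg : IsSelfReciprocal g) (hsl : IsSelfReciprocal l)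
    (hne : ¬ IsCoprime r22 (g11 * reflect m g12 - g12 * reflect m g11)) :
    ¬ IsLCDWith
      (Submodule.span (AdjoinRoot (X ^ m - 1 : F[X]))
        {(AdjoinRoot.mk (X ^ m - 1 : F[X]) g11, AdjoinRoot.mk (X ^ m - 1 : F[X]) g12), (0, AdjoinRoot.mk (X ^ m - 1 : F[X]) g22)})
      (qcSympInner hm) := by
  have hn0 : (X ^ m - 1 : F[X]) ≠ 0 := by
    simpa using (monic_X_pow_sub_C (1 : F) hm.ne').ne_zero
  have hdeg : (X ^ m - 1 : F[X]).natDegree = m := by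
    rw [← C_1, natDegree_X_pow_sub_C]
  have hsq := (separable_X_pow_sub_one_of_coprime_card hqm).squarefree
  have hg22 : g22 ≠ 0 := ne_zero_of_dvd_ne_zero hn0 h2
  have hd11 : g11.natDegree ≤ m := hdeg ▸ natDegree_le_of_dvd h1 hn0
  have hd22 : g22.natDegree ≤ m := hdeg ▸ natDegree_le_of_dvd h2 hn0
  have hd12 : g12.natDegree ≤ m := (natDegree_le_natDegree h3.le).trans hd22
  have hfac : g22 = g * g22' := by
    rw [h22']
    refine (EuclideanDomain.mul_div_cancel' ?_ ?_).symm
    · rintro rfl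
      exact hg22 (zero_dvd_iff.1 (hg ▸ gcd_dvd_right g11 g22))
    · exact hg ▸ gcd_dvd_right g11 g22
  have hg22'0 : g22' ≠ 0 := right_ne_zero_of_mul (hfac ▸ hg22)
  have hr0 : r22 ≠ 0 := ne_zero_of_dvd_ne_zero hg22'0 (hr22 ▸ gcd_dvd_left _ _)
  obtain ⟨p, hp, hpr, hpE⟩ : ∃ p : F[X], Irreducible p ∧ p ∣ r22 ∧
      p ∣ g11 * reflect m g12 - g12 * reflect m g11 := by
    by_contra! hcon
    exact hne (isCoprime_of_irreducible_dvd (fun h => hr0 h.1) fun p hp h => hcon p hp h)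
  have hpg22' : p ∣ g22' := hpr.trans (hr22 ▸ gcd_dvd_left _ _)
  have hprev : p ∣ g22'.reverse := hpr.trans (hr22 ▸ gcd_dvd_right _ _)
  have hpg22 : p ∣ g22 := hpg22'.trans (hfac ▸ dvd_mul_left _ _)
  have hpg11 : ¬ p ∣ g11 := fun h => by
    have hpg : p ∣ g := hg ▸ dvd_gcd h hpg22
    exact hp.not_isUnit (hsq p ((mul_dvd_mul hpg hpg22').trans (hfac ▸ h2)))
  have hprefl : p ∣ reflect m g22 := by
    rw [reflect_eq_reverse_mul g22 hd22, hfac, reverse_mul_of_domain]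
    exact ((hprev.mul_left _).mul_right _)
  obtain ⟨h, hh⟩ := hpg22.trans h2
  have hh0 : h ≠ 0 := right_ne_zero_of_mul (hh ▸ hn0)
  have hkill : ∀ f : F[X], p ∣ f →
      AdjoinRoot.mk (X ^ m - 1 : F[X]) h * AdjoinRoot.mk _ f = 0 := fun f hf => by
    rw [← map_mul, AdjoinRoot.mk_eq_zero, hh, mul_comm h]
    exact mul_dvd_mul_right hf h
  have hE := hkill _ hpE
  have hG := hkill _ hprefl
  simp only [map_sub, map_mul, mk_reflect hm _ hd11, mk_reflect hm _ hd12] at hE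
  rw [mk_reflect hm _ hd22] at hG
  have hE' := congrArg qcConj hE
  have hG' := congrArg qcConj hG
  simp only [map_sub, map_mul, map_zero, qcConj_qcConj hm] at hE' hG'
  intro hlcd
  have hv := hlcd (AdjoinRoot.mk (X ^ m - 1 : F[X]) h •
    (AdjoinRoot.mk (X ^ m - 1 : F[X]) g11, AdjoinRoot.mk (X ^ m - 1 : F[X]) g12))
    (Submodule.smul_mem _ _ (Submodule.subset_span (by simp))) ?_
  · have hv1 := congrArg Prod.fst hv
    simp only [Prod.smul_mk, smul_eq_mul, Prod.fst_zero] at hv1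
    rw [← map_mul, AdjoinRoot.mk_eq_zero, hh, mul_comm p] at hv1
    exact hpg11 ((mul_dvd_mul_iff_left hh0).1 hv1)
  · intro c hc
    obtain ⟨a, b, rfl⟩ := Submodule.mem_span_pair.1 hc
    rw [qcSympInner_eq]
    convert map_zero (qcConstCoeff (F := F) hm)
    simp only [Prod.smul_mk, Prod.mk_add_mk, smul_eq_mul, mul_zero, add_zero, map_mul]
    linear_combination (-a) * hE' - b * qcConj (AdjoinRoot.mk (X ^ m - 1 : F[X]) g11) * hG'
end
end

section
/- If the polynomial g(x) = gcd(g11(x), g22(x)) satisfies g(x) = gcd(g11(x), g11*(x)) = gcd(g22(x), g22*(x)), g is self-reciprocal, and the product g11(x)·g22(x) is self-reciprocal, then the code C is symplectic LCD. -/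
open Polynomial

noncomputable section

lemma X_pow_sub_one_monic (F : Type) [Field F] {m : ℕ} (hm : 0 < m) :
    (X ^ m - 1 : F[X]).Monic := by
  simpa using monic_X_pow_sub_C (1 : F) hm.ne'

lemma qcToVec_add {F : Type} [Field F] {m : ℕ} (hm : 0 < m)
    (a b : AdjoinRoot (X ^ m - 1 : F[X])) (i : Fin m) :
    qcToVec hm (a + b) i = qcToVec hm a i + qcToVec hm b i := by
  simp [qcToVec]

lemma qcToVec_mk_monomial {F : Type} [Field F] {m : ℕ} (hm : 0 < m) (n : ℕ) (c : F) (i : Fin m) :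
    qcToVec hm (AdjoinRoot.mk _ (monomial n c)) i = if n % m = i then c else 0 := by
  have hmod : AdjoinRoot.mk (X ^ m - 1 : F[X]) (monomial n c) =
      AdjoinRoot.mk (X ^ m - 1 : F[X]) (monomial (n % m) c) := by
    rw [AdjoinRoot.mk_eq_mk]
    have h : (X ^ m - 1 : F[X]) ∣ (X ^ m) ^ (n / m) - 1 := by
      simpa using sub_dvd_pow_sub_pow (X ^ m : F[X]) 1 (n / m)
    have h' : monomial n c - monomial (n % m) c =
        (C c * X ^ (n % m)) * ((X ^ m) ^ (n / m) - 1) := by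
      rw [← C_mul_X_pow_eq_monomial, ← C_mul_X_pow_eq_monomial, mul_sub, mul_one, mul_assoc,
        ← pow_mul, ← pow_add, Nat.mod_add_div]
    rw [h']
    exact h.mul_left _
  have hdeg : (monomial (n % m) c).degree < (X ^ m - 1 : F[X]).degree := by
    have : (X ^ m - 1 : F[X]).degree = m := by simpa using degree_X_pow_sub_C hm (1 : F)
    rw [this]
    exact (degree_monomial_le _ _).trans_lt (by exact_mod_cast Nat.mod_lt _ hm)
  rw [hmod, qcToVec, AdjoinRoot.modByMonicHom_mk,
    (modByMonic_eq_self_iff (X_pow_sub_one_monic F hm)).2 hdeg, coeff_monomial]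

/-- The weighted sum of the Euclidean products of the cyclic shifts of `p` with `q` factors as a
product of evaluations. -/
lemma sum_shift_inner_eq {F K : Type} [Field F] [Field K] [Algebra F K] {m : ℕ} (hm : 0 < m)
    {ξ ζ : K} (hξζ : ξ * ζ = 1) (hζ : ζ ^ m = 1) (p q : F[X]) :
    ∑ k : Fin m, ζ ^ (k : ℕ) * algebraMap F K
      (∑ i, qcToVec hm (AdjoinRoot.mk _ (X ^ (k : ℕ) * p)) i * qcToVec hm (AdjoinRoot.mk _ q) i) =
      aeval ξ p * aeval ζ q := by
  induction p using Polynomial.induction_on' with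
  | add p₁ p₂ h₁ h₂ =>
    simp only [mul_add, qcToVec_add, add_mul, Finset.sum_add_distrib, map_add, h₁, h₂]
  | monomial s c =>
    induction q using Polynomial.induction_on' with
    | add q₁ q₂ h₁ h₂ =>
      simp only [mul_add, qcToVec_add, Finset.sum_add_distrib, map_add, h₁, h₂]
    | monomial t d =>
      have hpow : ∀ n : ℕ, ζ ^ (n % m) = ζ ^ n := fun n => by
        conv_rhs => rw [← Nat.mod_add_div n m, pow_add, pow_mul, hζ, one_pow, mul_one]
      have hshift : ∀ n : ℕ, ξ ^ n = ζ ^ ((m - 1) * n) := fun n => by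
        have : ξ = ζ ^ (m - 1) := by
          have h : ζ ^ (m - 1) * ζ = 1 := by rw [← pow_succ, Nat.sub_add_cancel hm, hζ]
          calc ξ = ξ * (ζ ^ (m - 1) * ζ) := by rw [h, mul_one]
            _ = (ξ * ζ) * ζ ^ (m - 1) := by ring
            _ = ζ ^ (m - 1) := by rw [hξζ, one_mul]
        rw [this, ← pow_mul]
      have hinner : ∀ k : ℕ, (∑ i, qcToVec hm (AdjoinRoot.mk _ (X ^ k * monomial s c)) i *
          qcToVec hm (AdjoinRoot.mk _ (monomial t d)) i) =
          if (k + s) % m = t % m then c * d else 0 := fun k => by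
        rw [X_pow_mul_monomial]
        simp only [qcToVec_mk_monomial]
        rw [Finset.sum_eq_single ⟨t % m, Nat.mod_lt _ hm⟩]
        · simp [add_comm]
        · intro i _ hi
          rw [if_neg (c := t % m = i) (fun h => hi (Fin.ext h.symm)), mul_zero]
        · simp
      simp only [hinner]
      rw [Finset.sum_eq_single ⟨(t + (m - 1) * s) % m, Nat.mod_lt _ hm⟩]
      · have hk : ((t + (m - 1) * s) % m + s) % m = t % m := by
          rw [Nat.mod_add_mod, add_assoc, ← Nat.succ_mul, Nat.succ_eq_add_one,
            Nat.sub_add_cancel hm, Nat.add_mul_mod_self_left]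
        simp only [hk, if_true, hpow, aeval_monomial, hshift, map_mul, pow_add]
        ring
      · intro k _ hk
        rw [if_neg, map_zero, mul_zero]
        intro h
        apply hk
        ext
        have h' : (k + s) + (m - 1) * s ≡ t + (m - 1) * s [MOD m] := Nat.ModEq.add_right _ h
        rw [add_assoc, add_comm s, ← Nat.succ_mul, Nat.succ_eq_add_one,
            Nat.sub_add_cancel hm, Nat.ModEq, Nat.add_mul_mod_self_left,
            Nat.mod_eq_of_lt k.2] at h'
        exact h'
      · simp

/-- A codeword of the symplectic dual is orthogonal to the code at each `m`-th root of unity. -/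
lemma aeval_mul_eq_of_qcSympInner_eq_zero {F K : Type} [Field F] [Field K] [Algebra F K] {m : ℕ}
    (hm : 0 < m) {ξ ζ : K} (hξζ : ξ * ζ = 1) (hζ : ζ ^ m = 1) (a b p₁ p₂ : F[X])
    (h : ∀ k : ℕ, qcSympInner hm (AdjoinRoot.mk _ (X ^ k * a), AdjoinRoot.mk _ (X ^ k * b))
      (AdjoinRoot.mk _ p₁, AdjoinRoot.mk _ p₂) = 0) :
    aeval ξ a * aeval ζ p₂ = aeval ξ b * aeval ζ p₁ := by
  rw [← sum_shift_inner_eq hm hξζ hζ, ← sum_shift_inner_eq hm hξζ hζ]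
  refine Finset.sum_congr rfl fun k _ => ?_
  rw [sub_eq_zero.1 (h k)]

lemma aeval_reverse_eq_zero_iff {F K : Type} [Field F] [Field K] [Algebra F K] {ξ ζ : K}
    (hξζ : ξ * ζ = 1) (f : F[X]) : aeval ζ f.reverse = 0 ↔ aeval ξ f = 0 := by
  let u : Kˣ := ⟨ξ, ζ, hξζ, by rw [mul_comm, hξζ]⟩
  let _ : Invertible ξ := ⟨ζ, by rw [mul_comm, hξζ], hξζ⟩
  exact eval₂_reverse_eq_zero_iff (algebraMap F K) ξ f

lemma X_pow_sub_one_dvd_of_forall_root {F : Type} [Field F] {m : ℕ} (hm : (m : F) ≠ 0) (p : F[X])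
    (h : ∀ ζ : AlgebraicClosure F, ζ ^ m = 1 → aeval ζ p = 0) : X ^ m - 1 ∣ p := by
  rcases eq_or_ne p 0 with rfl | hp
  · exact dvd_zero _
  have hsep : (X ^ m - 1 : F[X]).Separable := X_pow_sub_one_separable_iff.2 hm
  rw [← map_dvd_map' (algebraMap F (AlgebraicClosure F))]
  refine (IsAlgClosed.splits _).dvd_of_roots_le_roots (hsep.map.ne_zero) ?_
  rw [Multiset.le_iff_subset (nodup_roots hsep.map)]
  intro ζ hζ
  have hζ' := (mem_roots'.1 hζ).2
  rw [mem_roots (Polynomial.map_ne_zero hp), IsRoot, eval_map_algebraMap]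
  apply h
  simpa [IsRoot, sub_eq_zero] using hζ'

lemma aeval_gcd_eq_zero {F K : Type} [Field F] [DecidableEq F] [Field K] [Algebra F K] {ζ : K}
    {f g : F[X]} (hf : aeval ζ f = 0) (hg : aeval ζ g = 0) : aeval ζ (gcd f g) = 0 := by
  rw [← minpoly.dvd_iff] at *
  exact dvd_gcd hf hg

lemma natCast_ne_zero_of_coprime_card {F : Type} [Field F] [Fintype F] {m : ℕ}
    (h : Nat.Coprime (Fintype.card F) m) : (m : F) ≠ 0 := by
  have h' : IsCoprime ((Fintype.card F : ℕ) : F) (m : F) := h.cast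
  rw [FiniteField.cast_card_eq_zero, isCoprime_zero_left] at h'
  exact h'.ne_zero

lemma aeval_eq_zero_of_common_root {F K : Type} [Field F] [Field K] [Algebra F K]
    [Algebra.IsAlgebraic F K] {ζ : K} {N f g p : F[X]} (hN : N.Separable) (hfN : f ∣ N)
    (hdvd : f * g ∣ N * p) (hf : aeval ζ f = 0) (hg : aeval ζ g = 0) : aeval ζ p = 0 := by
  rw [← minpoly.dvd_iff] at *
  have hint : IsIntegral F ζ := Algebra.IsIntegral.isIntegral ζ
  have hprime := minpoly.prime hint
  obtain ⟨h, rfl⟩ := hf.trans hfN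
  have h₂ : minpoly F ζ * minpoly F ζ ∣ minpoly F ζ * (h * p) := by
    rw [← mul_assoc]
    exact (mul_dvd_mul hf hg).trans hdvd
  rcases hprime.dvd_or_dvd ((mul_dvd_mul_iff_left hprime.ne_zero).1 h₂) with h₃ | h₃
  · exact absurd (hN.squarefree _ (mul_dvd_mul_left _ h₃)) hprime.not_isUnit
  · exact h₃

/-- If `g = gcd(g11, g22) = gcd(g11, g11*) = gcd(g22, g22*)` is self-reciprocal and
`g11·g22` is self-reciprocal, then the quasi-cyclic code
`C = ⟨(g11, g12), (0, g22)⟩` is symplectic LCD. -/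
theorem stmt15 (F : Type) [Field F] [Fintype F] [DecidableEq F] (m : ℕ) (hm : 0 < m)
    (hqm : Nat.Coprime (Fintype.card F) m)
    (g11 g12 g22 : F[X])
    (h1 : g11 ∣ X ^ m - 1) (h2 : g22 ∣ X ^ m - 1)
    (h3 : g12.degree < g22.degree) (h4 : g11 * g22 ∣ (X ^ m - 1) * g12)
    (hgcd1 : gcd g11 g22 = gcd g11 g11.reverse)
    (hgcd2 : gcd g11 g22 = gcd g22 g22.reverse)
    (hsg : IsSelfReciprocal (gcd g11 g22))
    (hprod : IsSelfReciprocal (g11 * g22)) :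
    IsLCDWith
      (Submodule.span (AdjoinRoot (X ^ m - 1 : F[X]))
        {(AdjoinRoot.mk (X ^ m - 1 : F[X]) g11, AdjoinRoot.mk (X ^ m - 1 : F[X]) g12), (0, AdjoinRoot.mk (X ^ m - 1 : F[X]) g22)})
      (qcSympInner hm) := by
  intro v hv hdual
  obtain ⟨a, b, rfl⟩ := Submodule.mem_span_pair.1 hv
  obtain ⟨A, rfl⟩ := AdjoinRoot.mk_surjective a
  obtain ⟨B, rfl⟩ := AdjoinRoot.mk_surjective b
  have hmF := natCast_ne_zero_of_coprime_card hqm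
  have hsep : (X ^ m - 1 : F[X]).Separable := X_pow_sub_one_separable_iff.2 hmF
  have hv' : AdjoinRoot.mk (X ^ m - 1 : F[X]) A • (AdjoinRoot.mk (X ^ m - 1 : F[X]) g11,
        AdjoinRoot.mk (X ^ m - 1 : F[X]) g12) +
      AdjoinRoot.mk (X ^ m - 1 : F[X]) B •
        ((0 : AdjoinRoot (X ^ m - 1 : F[X])), AdjoinRoot.mk (X ^ m - 1 : F[X]) g22) =
      (AdjoinRoot.mk _ (A * g11), AdjoinRoot.mk _ (A * g12 + B * g22)) := by
    simp
  rw [hv'] at hdual ⊢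
  suffices h : ∀ ζ : AlgebraicClosure F, ζ ^ m = 1 →
      aeval ζ (A * g11) = 0 ∧ aeval ζ (A * g12 + B * g22) = 0 by
    rw [Prod.mk_eq_zero, AdjoinRoot.mk_eq_zero, AdjoinRoot.mk_eq_zero]
    exact ⟨X_pow_sub_one_dvd_of_forall_root hmF _ fun ζ hζ => (h ζ hζ).1,
      X_pow_sub_one_dvd_of_forall_root hmF _ fun ζ hζ => (h ζ hζ).2⟩
  intro ζ hζ
  have hξζ : ζ⁻¹ * ζ = 1 := by
    refine inv_mul_cancel₀ ?_
    rintro rfl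
    simp [hm.ne'] at hζ
  have e1 : aeval ζ⁻¹ g11 * aeval ζ (A * g12 + B * g22) = aeval ζ⁻¹ g12 * aeval ζ (A * g11) := by
    refine aeval_mul_eq_of_qcSympInner_eq_zero hm hξζ hζ _ _ _ _ fun k => hdual _ ?_
    rw [Submodule.mem_span_pair]
    exact ⟨AdjoinRoot.mk _ (X ^ k), 0, by simp⟩
  have e2 : aeval ζ⁻¹ g22 * aeval ζ (A * g11) = 0 := by
    have := aeval_mul_eq_of_qcSympInner_eq_zero hm hξζ hζ 0 g22 (A * g11) (A * g12 + B * g22)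
      fun k => hdual _ ?_
    · simpa using this.symm
    · rw [Submodule.mem_span_pair]
      exact ⟨0, AdjoinRoot.mk _ (X ^ k), by simp⟩
  have c1 : aeval ζ g11 = 0 → aeval ζ⁻¹ g11 = 0 → aeval ζ g22 = 0 := fun h h' => by
    have := aeval_gcd_eq_zero h ((aeval_reverse_eq_zero_iff hξζ g11).2 h')
    rw [← hgcd1] at this
    exact aeval_eq_zero_of_dvd_aeval_eq_zero (gcd_dvd_right _ _) this
  have c2 : aeval ζ g22 = 0 → aeval ζ⁻¹ g22 = 0 → aeval ζ g11 = 0 := fun h h' => by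
    have := aeval_gcd_eq_zero h ((aeval_reverse_eq_zero_iff hξζ g22).2 h')
    rw [← hgcd2] at this
    exact aeval_eq_zero_of_dvd_aeval_eq_zero (gcd_dvd_left _ _) this
  have c3 : aeval ζ⁻¹ g11 = 0 ∨ aeval ζ⁻¹ g22 = 0 → aeval ζ g11 = 0 ∨ aeval ζ g22 = 0 := by
    obtain ⟨α, hα, hrev⟩ := hprod
    have := aeval_reverse_eq_zero_iff hξζ (g11 * g22)
    rw [hrev] at this
    simpa [hα] using this.2
  have c4 : aeval ζ g11 = 0 → aeval ζ g22 = 0 → aeval ζ g12 = 0 :=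
    aeval_eq_zero_of_common_root hsep h1 h4
  simp only [map_mul, map_add] at e1 e2 ⊢
  by_cases z1 : aeval ζ g11 = 0 <;> by_cases z2 : aeval ζ g22 = 0
  · simp [z1, z2, c4 z1 z2]
  · have n1 : aeval ζ⁻¹ g11 ≠ 0 := fun h => z2 (c1 z1 h)
    simpa [z1, n1] using e1
  · have n2 : aeval ζ⁻¹ g22 ≠ 0 := fun h => z1 (c2 z2 h)
    have hA : aeval ζ A = 0 := by simpa [n2, z1] using e2
    simp [hA, z2]
  · have n1 : aeval ζ⁻¹ g11 ≠ 0 := fun h => (c3 (Or.inl h)).elim z1 z2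
    have n2 : aeval ζ⁻¹ g22 ≠ 0 := fun h => (c3 (Or.inr h)).elim z1 z2
    have hA : aeval ζ A = 0 := by simpa [n2, z1] using e2
    refine ⟨by simp [hA], ?_⟩
    simpa [hA, n1] using e1
end
end
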